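/- arXiv:1508.07734 — 6 statements merged into one kernel-verified Lean document; each statement's English description precedes it below -/
import Mathlib

section
/- Let X be a Tychonoff (completely regular Hausdorff) space and let (H_i)_{i∈I} be a nonempty family of ideals of C_B(X). (1) If every H_i is non-vanishing, then λ_K X = ⋃_{i∈I} λ_{cl(H_i)} X, where K denotes the norm-closure of the ideal of C_B(X) generated by ⋃_{i∈I} H_i and cl(H_i) the norm-closure of H_i. (2) If moreover for each i ∈ I the intersection of H_i with the ideal generated by ⋃_{j≠i} H_j is {0}, and the ideal generated by ⋃_{i∈I} H_i is non-vanishing, then the sets λ_{cl(H_i)} X, i ∈ I, are pairwise disjoint open subsets of βX whose union is λ_K X. -/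
open Set Filter Topology BoundedContinuousFunction

noncomputable section

/-- The subspace `λ_H X = ⋃_{h ∈ H} cl_{βX} {x : |h x| > 1}` of `βX`. -/
def lambdaH {X : Type*} [TopologicalSpace X] (H : Set (X →ᵇ ℂ)) : Set (StoneCech X) :=
  ⋃ h ∈ H, closure (stoneCechUnit '' {x : X | 1 < ‖h x‖})

/-- The continuous extension of a bounded continuous function to the Stone–Čech
compactification. -/
def bcfExtend {X : Type*} [TopologicalSpace X] (f : X →ᵇ ℂ) : StoneCech X → ℂ :=
  fun p => (stoneCechExtend (β := Metric.closedBall (0 : ℂ) ‖f‖)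
    (g := fun x => ⟨f x, mem_closedBall_zero_iff.2 (f.norm_coe_le_norm x)⟩)
    (f.continuous.subtype_mk _) p : ℂ)

section bcfExtend

variable {X : Type*} [TopologicalSpace X]

lemma continuous_bcfExtend (f : X →ᵇ ℂ) : Continuous (bcfExtend f) :=
  continuous_subtype_val.comp (continuous_stoneCechExtend _)

@[simp]
lemma bcfExtend_stoneCechUnit (f : X →ᵇ ℂ) (x : X) : bcfExtend f (stoneCechUnit x) = f x := by
  simp only [bcfExtend, stoneCechExtend_stoneCechUnit]

lemma norm_bcfExtend_le (f : X →ᵇ ℂ) (p : StoneCech X) : ‖bcfExtend f p‖ ≤ ‖f‖ :=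
  mem_closedBall_zero_iff.1 (Subtype.prop _)

lemma bcfExtend_eq {f : X →ᵇ ℂ} {g : StoneCech X → ℂ} (hg : Continuous g)
    (h : ∀ x, f x = g (stoneCechUnit x)) : bcfExtend f = g :=
  denseRange_stoneCechUnit.equalizer (continuous_bcfExtend f) hg (by ext x; simp [h])

/-- Evaluation at a point of the Stone–Čech compactification, as a ring homomorphism. -/
def bcfEval (p : StoneCech X) : (X →ᵇ ℂ) →+* ℂ where
  toFun f := bcfExtend f p
  map_one' := congrFun (bcfExtend_eq (g := fun _ => 1) continuous_const fun _ => rfl) p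
  map_zero' := congrFun (bcfExtend_eq (g := fun _ => 0) continuous_const fun _ => rfl) p
  map_add' f g := congrFun (bcfExtend_eq (g := fun q => bcfExtend f q + bcfExtend g q)
    ((continuous_bcfExtend f).add (continuous_bcfExtend g)) fun x => by simp) p
  map_mul' f g := congrFun (bcfExtend_eq (g := fun q => bcfExtend f q * bcfExtend g q)
    ((continuous_bcfExtend f).mul (continuous_bcfExtend g)) fun x => by simp) p

lemma continuous_bcfEval (f : X →ᵇ ℂ) : Continuous fun p => bcfEval p f :=
  continuous_bcfExtend f

lemma bcfEval_stoneCechUnit (f : X →ᵇ ℂ) (x : X) : bcfEval (stoneCechUnit x) f = f x :=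
  bcfExtend_stoneCechUnit f x

lemma norm_bcfEval_le (f : X →ᵇ ℂ) (p : StoneCech X) : ‖bcfEval p f‖ ≤ ‖f‖ :=
  norm_bcfExtend_le f p

lemma one_le_norm_bcfEval {f : X →ᵇ ℂ} {p : StoneCech X}
    (hp : p ∈ closure (stoneCechUnit '' {x : X | 1 < ‖f x‖})) : 1 ≤ ‖bcfEval p f‖ := by
  refine closure_minimal (t := {q | 1 ≤ ‖bcfEval q f‖}) ?_
    (isClosed_le continuous_const (continuous_bcfEval f).norm) hp
  rintro _ ⟨x, hx, rfl⟩
  simpa only [mem_ofPred_eq, bcfEval_stoneCechUnit] using le_of_lt hx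

lemma mem_closure_of_one_lt_norm_bcfEval {f : X →ᵇ ℂ} {p : StoneCech X}
    (hp : 1 < ‖bcfEval p f‖) : p ∈ closure (stoneCechUnit '' {x : X | 1 < ‖f x‖}) := by
  refine closure_mono ?_ (denseRange_stoneCechUnit.open_subset_closure_inter
    (isOpen_lt continuous_const (continuous_bcfEval f).norm) hp)
  rintro _ ⟨hq, x, rfl⟩
  exact ⟨x, by simpa only [mem_ofPred_eq, bcfEval_stoneCechUnit] using hq, rfl⟩

lemma mem_lambdaH_closure_iff (I : Ideal (X →ᵇ ℂ)) (p : StoneCech X) :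
    p ∈ lambdaH (closure (I : Set (X →ᵇ ℂ))) ↔ ∃ f ∈ I, bcfEval p f ≠ 0 := by
  simp only [lambdaH, mem_iUnion, exists_prop]
  constructor
  · rintro ⟨h, hh, hp⟩
    obtain ⟨f, hf, hd⟩ := Metric.mem_closure_iff.1 hh 1 one_pos
    refine ⟨f, hf, fun h0 => ?_⟩
    have hle := norm_bcfEval_le (h - f) p
    rw [map_sub, h0, sub_zero, ← dist_eq_norm] at hle
    linarith [one_le_norm_bcfEval hp]
  · rintro ⟨f, hf, hne⟩
    have hconst : bcfEval p (BoundedContinuousFunction.const X (2 / bcfEval p f)) =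
        2 / bcfEval p f :=
      congrFun (bcfExtend_eq (g := fun _ => 2 / bcfEval p f) continuous_const fun _ => rfl) p
    refine ⟨BoundedContinuousFunction.const X (2 / bcfEval p f) * f,
      subset_closure (I.mul_mem_left _ hf), mem_closure_of_one_lt_norm_bcfEval ?_⟩
    rw [map_mul, hconst, div_mul_cancel₀ _ hne]
    norm_num

lemma notMem_lambdaH_closure_iff (I : Ideal (X →ᵇ ℂ)) (p : StoneCech X) :
    p ∉ lambdaH (closure (I : Set (X →ᵇ ℂ))) ↔ I ≤ RingHom.ker (bcfEval p) := by
  simp [mem_lambdaH_closure_iff, SetLike.le_def, RingHom.mem_ker]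

lemma isOpen_lambdaH_closure (I : Ideal (X →ᵇ ℂ)) :
    IsOpen (lambdaH (closure (I : Set (X →ᵇ ℂ)))) := by
  have h : lambdaH (closure (I : Set (X →ᵇ ℂ))) = ⋃ f ∈ I, {p | bcfEval p f ≠ 0} := by
    ext p
    simp [mem_lambdaH_closure_iff]
  rw [h]
  exact isOpen_biUnion fun f _ => isOpen_ne_fun (continuous_bcfEval f) continuous_const

lemma lambdaH_closure_iSup {ι : Type*} (H : ι → Ideal (X →ᵇ ℂ)) :
    lambdaH (closure ((⨆ i, H i : Ideal (X →ᵇ ℂ)) : Set (X →ᵇ ℂ))) =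
      ⋃ i, lambdaH (closure (H i : Set (X →ᵇ ℂ))) := by
  ext p
  rw [← not_iff_not, notMem_lambdaH_closure_iff]
  simp only [mem_iUnion, not_exists, notMem_lambdaH_closure_iff, iSup_le_iff]

lemma disjoint_lambdaH_closure {I J : Ideal (X →ᵇ ℂ)} (h : Disjoint I J) :
    Disjoint (lambdaH (closure (I : Set (X →ᵇ ℂ)))) (lambdaH (closure (J : Set (X →ᵇ ℂ)))) := by
  refine Set.disjoint_left.2 fun p hI hJ => ?_
  obtain ⟨f, hf, hfp⟩ := (mem_lambdaH_closure_iff I p).1 hI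
  obtain ⟨g, hg, hgp⟩ := (mem_lambdaH_closure_iff J p).1 hJ
  have hfg : f * g = 0 :=
    Submodule.disjoint_def.1 h _ (I.mul_mem_right _ hf) (J.mul_mem_left _ hg)
  exact mul_ne_zero hfp hgp (by rw [← map_mul, hfg, map_zero])

end bcfExtend

theorem stmt_13 {X : Type*} [TopologicalSpace X] [T35Space X]
    {ι : Type*} [Nonempty ι] (H : ι → Ideal (X →ᵇ ℂ)) :
    -- (1)
    ((∀ i : ι, ∀ x : X, ∃ h ∈ H i, h x ≠ 0) →
      lambdaH (closure ((⨆ i, H i : Ideal (X →ᵇ ℂ)) : Set (X →ᵇ ℂ))) =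
        ⋃ i : ι, lambdaH (closure ((H i : Set (X →ᵇ ℂ))))) ∧
    -- (2)
    ((∀ i : ι, H i ⊓ (⨆ j ∈ {j : ι | j ≠ i}, H j) = ⊥) →
      (∀ x : X, ∃ h ∈ (⨆ i, H i : Ideal (X →ᵇ ℂ)), h x ≠ 0) →
      (∀ i : ι, IsOpen (lambdaH (closure ((H i : Set (X →ᵇ ℂ)))))) ∧
      (Pairwise fun i j : ι =>
        Disjoint (lambdaH (closure ((H i : Set (X →ᵇ ℂ)))))
          (lambdaH (closure ((H j : Set (X →ᵇ ℂ)))))) ∧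
      (⋃ i : ι, lambdaH (closure ((H i : Set (X →ᵇ ℂ)))) =
        lambdaH (closure ((⨆ i, H i : Ideal (X →ᵇ ℂ)) : Set (X →ᵇ ℂ))))) := by
  refine ⟨fun _ => lambdaH_closure_iSup H, fun hdisj _ => ⟨fun i => isOpen_lambdaH_closure (H i),
    fun i j hij => disjoint_lambdaH_closure ?_, (lambdaH_closure_iSup H).symm⟩⟩
  exact (disjoint_iff.2 (hdisj i)).mono_right (le_biSup H (show j ∈ {j | j ≠ i} from hij.symm))
end
end

section
/- Let X be a Tychonoff (completely regular Hausdorff) space and let (H_i)_{i∈I} be a nonempty family of closed ideals of C_B(X) such that ⋂_{i∈I} H_i is non-vanishing. Then λ_J X = int_{βX} ( ⋂_{i∈I} λ_{H_i} X ), where J denotes the norm-closure of ⋂_{i∈I} H_i and int_{βX} denotes interior in βX. -/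
open Set Filter Topology BoundedContinuousFunction

noncomputable section

/-- Restriction of a continuous function on `βX` to a bounded continuous function on `X`. -/
def stoneCechRestrict (X : Type*) [TopologicalSpace X] : C(StoneCech X, ℂ) →+* (X →ᵇ ℂ) where
  toFun g := (mkOfCompact g).compContinuous ⟨stoneCechUnit, continuous_stoneCechUnit⟩
  map_one' := rfl
  map_mul' _ _ := rfl
  map_zero' := rfl
  map_add' _ _ := rfl

section

variable {X : Type*} [TopologicalSpace X]

@[simp]
theorem stoneCechRestrict_apply (g : C(StoneCech X, ℂ)) (x : X) :
    stoneCechRestrict X g x = g (stoneCechUnit x) := rfl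

theorem continuous_stoneCechRestrict : Continuous (stoneCechRestrict X) :=
  (BoundedContinuousFunction.continuous_compContinuous _).comp
    (ContinuousMap.isometryEquivBoundedOfCompact (StoneCech X) ℂ).continuous

theorem stoneCechRestrict_surjective : Function.Surjective (stoneCechRestrict X) := by
  intro h
  have hmem : ∀ x, h x ∈ Metric.closedBall (0 : ℂ) ‖h‖ := fun x => by
    simpa using h.norm_coe_le_norm x
  have : CompactSpace (Metric.closedBall (0 : ℂ) ‖h‖) :=
    isCompact_iff_compactSpace.mp (isCompact_closedBall _ _)
  have hc : Continuous fun x => (⟨h x, hmem x⟩ : Metric.closedBall (0 : ℂ) ‖h‖) :=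
    h.continuous.subtype_mk hmem
  refine ⟨⟨fun p => (stoneCechExtend hc p).val,
    continuous_subtype_val.comp (continuous_stoneCechExtend hc)⟩, ?_⟩
  ext x
  simp [stoneCechExtend_stoneCechUnit]

theorem lambdaH_eq_setOfIdeal (I : Ideal (X →ᵇ ℂ)) :
    lambdaH (I : Set (X →ᵇ ℂ)) = ContinuousMap.setOfIdeal (I.comap (stoneCechRestrict X)) := by
  ext p
  simp only [lambdaH, mem_iUnion, SetLike.mem_coe, ContinuousMap.mem_setOfIdeal,
    Ideal.mem_comap, exists_prop]
  constructor
  · rintro ⟨h, hI, hp⟩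
    obtain ⟨g, rfl⟩ := stoneCechRestrict_surjective h
    refine ⟨g, hI, fun h0 => ?_⟩
    have hcl : IsClosed {q | 1 ≤ ‖g q‖} := isClosed_le continuous_const g.continuous.norm
    have hsub : stoneCechUnit '' {x | 1 < ‖stoneCechRestrict X g x‖} ⊆ {q | 1 ≤ ‖g q‖} := by
      rintro _ ⟨x, hx, rfl⟩
      exact (show 1 < ‖stoneCechRestrict X g x‖ from hx).le
    have h1 : 1 ≤ ‖g p‖ := closure_minimal hsub hcl hp
    norm_num [h0] at h1
  · rintro ⟨g, hI, hp⟩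
    set k : C(StoneCech X, ℂ) := ContinuousMap.const _ (2 / g p) * g with hk
    refine ⟨stoneCechRestrict X k, by rw [hk, map_mul]; exact I.mul_mem_left _ hI, ?_⟩
    have hkp : p ∈ {q | 1 < ‖k q‖} := by simp [hk, hp]
    have hopen : IsOpen {q | 1 < ‖k q‖} := isOpen_lt continuous_const k.continuous.norm
    have := denseRange_stoneCechUnit.open_subset_closure_inter hopen hkp
    rwa [inter_comm, ← image_preimage_eq_range_inter] at this

end

theorem stmt_14 {X : Type*} [TopologicalSpace X] [T35Space X]
    {ι : Type*} [Nonempty ι] (H : ι → Ideal (X →ᵇ ℂ))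
    (hclosed : ∀ i, IsClosed ((H i : Set (X →ᵇ ℂ))))
    (hnv : ∀ x : X, ∃ h ∈ ⋂ i, (H i : Set (X →ᵇ ℂ)), h x ≠ 0) :
    lambdaH (closure (⋂ i, (H i : Set (X →ᵇ ℂ)))) =
      interior (⋂ i, lambdaH ((H i : Set (X →ᵇ ℂ)))) := by
  have hideal : ∀ i, (H i).comap (stoneCechRestrict X) =
      ContinuousMap.idealOfSet ℂ (lambdaH (H i : Set (X →ᵇ ℂ))) := fun i => by
    rw [lambdaH_eq_setOfIdeal, ContinuousMap.idealOfSet_ofIdeal_isClosed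
      ((hclosed i).preimage continuous_stoneCechRestrict)]
  rw [(isClosed_iInter hclosed).closure_eq, ← Submodule.coe_iInf, lambdaH_eq_setOfIdeal,
    Ideal.comap_iInf]
  simp_rw [hideal]
  rw [← (ContinuousMap.ideal_gc (StoneCech X) ℂ).u_iInf,
    ContinuousMap.setOfIdeal_ofSet_eq_interior, iInf_eq_iInter]
end
end

section
/- Let X be a Tychonoff (completely regular Hausdorff) space and let (H_i)_{i∈I} be a family of non-vanishing closed ideals of C_B(X) such that the norm-closure of the ideal of C_B(X) generated by ⋃_{i∈I} H_i equals C_B(X). Then there exist finitely many indices i_1, …, i_n ∈ I such that the norm-closure of the ideal generated by H_{i_1} ∪ ⋯ ∪ H_{i_n} equals C_B(X). -/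
open Set Filter Topology BoundedContinuousFunction

noncomputable section

theorem Ideal.eq_top_of_dense {R : Type*} [NormedRing R] [HasSummableGeomSeries R]
    (I : Ideal R) (hI : closure (I : Set R) = Set.univ) : I = ⊤ := by
  by_contra h
  refine I.closure_ne_top h (SetLike.coe_injective ?_)
  rw [Ideal.coe_closure, hI, Submodule.top_coe]

theorem stmt_15 {X : Type*} [TopologicalSpace X] [T35Space X]
    {ι : Type*} (H : ι → Ideal (X →ᵇ ℂ))
    (hclosed : ∀ i, IsClosed ((H i : Set (X →ᵇ ℂ))))
    (hnv : ∀ i : ι, ∀ x : X, ∃ h ∈ H i, h x ≠ 0)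
    (htop : closure ((⨆ i, H i : Ideal (X →ᵇ ℂ)) : Set (X →ᵇ ℂ)) =
      (Set.univ : Set (X →ᵇ ℂ))) :
    ∃ s : Finset ι,
      closure ((⨆ i ∈ s, H i : Ideal (X →ᵇ ℂ)) : Set (X →ᵇ ℂ)) =
        (Set.univ : Set (X →ᵇ ℂ)) := by
  have h_one : (1 : X →ᵇ ℂ) ∈ ⨆ i, H i := by
    rw [Ideal.eq_top_of_dense _ htop]
    exact Submodule.mem_top
  obtain ⟨s, hs⟩ := Submodule.mem_iSup_iff_exists_finset.mp h_one
  refine ⟨s, ?_⟩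
  rw [(Ideal.eq_top_iff_one _).mpr hs, Submodule.top_coe, closure_univ]
end
end

section
/- Let X be a normal Hausdorff space. The set of all closed open bornologies in X, partially ordered by inclusion, is order-isomorphic to the set of all non-vanishing closed ideals of C_B(X), partially ordered by inclusion. -/
open Set Filter Topology BoundedContinuousFunction

noncomputable section

/-- A (set-theoretic) ideal in a set `X`: a nonempty collection of subsets of `X` closed under
taking subsets and finite unions. -/
def IsSetIdeal {X : Type*} (I : Set (Set X)) : Prop :=
  I.Nonempty ∧ (∀ A B : Set X, A ⊆ B → B ∈ I → A ∈ I) ∧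
    ∀ A B : Set X, A ∈ I → B ∈ I → A ∪ B ∈ I

/-- A closed open bornology in a topological space `X`: a set ideal covering `X` in which
every member is contained in a closed member and in an open member. -/
def IsClosedOpenBornology {X : Type*} [TopologicalSpace X] (𝔅 : Set (Set X)) : Prop :=
  IsSetIdeal 𝔅 ∧ ⋃₀ 𝔅 = Set.univ ∧
    (∀ B ∈ 𝔅, ∃ C ∈ 𝔅, IsClosed C ∧ B ⊆ C) ∧
    (∀ B ∈ 𝔅, ∃ U ∈ 𝔅, IsOpen U ∧ B ⊆ U)

/-- The functions all of whose superlevel sets `{x | ε ≤ ‖f x‖}`, `ε > 0`, belong to the set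
ideal `I`: those that vanish at infinity along `I`. -/
def vanishingIdeal {X : Type*} [TopologicalSpace X] (I : Set (Set X)) (hI : IsSetIdeal I) :
    Ideal (X →ᵇ ℂ) where
  carrier := {f | ∀ ε : ℝ, 0 < ε → {x | ε ≤ ‖f x‖} ∈ I}
  zero_mem' := by
    intro ε hε
    obtain ⟨A, hA⟩ := hI.1
    refine hI.2.1 _ A (fun x hx => ?_) hA
    simp only [mem_ofPred_eq, BoundedContinuousFunction.coe_zero, Pi.zero_apply, norm_zero] at hx
    exact absurd hx hε.not_ge
  add_mem' := by
    intro f g hf hg ε hε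
    refine hI.2.1 _ _ (fun x hx => ?_)
      (hI.2.2 _ _ (hf (ε / 2) (half_pos hε)) (hg (ε / 2) (half_pos hε)))
    by_contra! hcon
    simp only [mem_union, mem_ofPred_eq, not_or, not_le] at hcon
    have hle : ε ≤ ‖f x + g x‖ := hx
    linarith [norm_add_le (f x) (g x), hcon.1, hcon.2]
  smul_mem' := by
    intro g f hf ε hε
    have hpos : 0 < ‖g‖ + 1 := by positivity
    refine hI.2.1 _ _ (fun x hx => ?_) (hf (ε / (‖g‖ + 1)) (div_pos hε hpos))
    have hle : ε ≤ ‖g x * f x‖ := hx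
    rw [norm_mul] at hle
    rw [mem_ofPred_eq, div_le_iff₀ hpos]
    nlinarith [g.norm_coe_le_norm x, norm_nonneg (f x)]

theorem isClosed_vanishingIdeal {X : Type*} [TopologicalSpace X] {I : Set (Set X)}
    (hI : IsSetIdeal I) : IsClosed (vanishingIdeal I hI : Set (X →ᵇ ℂ)) := by
  refine isClosed_of_closure_subset fun f hf ε hε => ?_
  obtain ⟨g, hg, hfg⟩ := Metric.mem_closure_iff.1 hf (ε / 2) (half_pos hε)
  refine hI.2.1 _ _ (fun x hx => ?_) (hg (ε / 2) (half_pos hε))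
  have hle : ε ≤ ‖f x‖ := hx
  have hdist : ‖f x - g x‖ ≤ dist f g := by
    rw [← dist_eq_norm]
    exact BoundedContinuousFunction.dist_coe_le_dist x
  rw [mem_ofPred_eq]
  linarith [norm_sub_norm_le (f x) (g x)]

/-- The sets on which some member of `H` is bounded away from zero. -/
def coboundedSets {X : Type*} [TopologicalSpace X] (H : Ideal (X →ᵇ ℂ)) : Set (Set X) :=
  {B | ∃ h ∈ H, ∀ x ∈ B, 1 ≤ ‖h x‖}

theorem setOf_le_norm_mem_coboundedSets {X : Type*} [TopologicalSpace X] {H : Ideal (X →ᵇ ℂ)}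
    {f : X →ᵇ ℂ} (hf : f ∈ H) {ε : ℝ} (hε : 0 < ε) : {x | ε ≤ ‖f x‖} ∈ coboundedSets H := by
  refine ⟨BoundedContinuousFunction.const X ((ε⁻¹ : ℝ) : ℂ) * f, H.mul_mem_left _ hf,
    fun x hx => ?_⟩
  have hle : ε ≤ ‖f x‖ := hx
  rw [BoundedContinuousFunction.mul_apply, BoundedContinuousFunction.const_apply, norm_mul,
    Complex.norm_real, Real.norm_of_nonneg (inv_nonneg.2 hε.le), inv_mul_eq_div, one_le_div hε]
  exact hle

theorem isSetIdeal_coboundedSets {X : Type*} [TopologicalSpace X] (H : Ideal (X →ᵇ ℂ)) :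
    IsSetIdeal (coboundedSets H) := by
  refine ⟨⟨∅, 0, H.zero_mem, by simp⟩, ?_, ?_⟩
  · rintro A B hAB ⟨h, hh, hB⟩
    exact ⟨h, hh, fun x hx => hB x (hAB hx)⟩
  · rintro A B ⟨f, hf, hA⟩ ⟨g, hg, hB⟩
    refine ⟨star f * f + star g * g, H.add_mem (H.mul_mem_left _ hf) (H.mul_mem_left _ hg),
      fun x hx => ?_⟩
    have hval : (star f * f + star g * g) x = ((‖f x‖ ^ 2 + ‖g x‖ ^ 2 : ℝ) : ℂ) := by
      simp [Complex.conj_mul']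
    rw [hval, Complex.norm_real, Real.norm_of_nonneg (by positivity)]
    rcases hx with hx | hx
    · nlinarith [hA x hx, sq_nonneg ‖g x‖]
    · nlinarith [hB x hx, sq_nonneg ‖f x‖]

theorem isClosedOpenBornology_coboundedSets {X : Type*} [TopologicalSpace X] {H : Ideal (X →ᵇ ℂ)}
    (hH : ∀ x : X, ∃ h ∈ H, h x ≠ 0) : IsClosedOpenBornology (coboundedSets H) := by
  refine ⟨isSetIdeal_coboundedSets H, ?_, ?_, ?_⟩
  · refine eq_univ_of_forall fun x => ?_
    obtain ⟨h, hh, hx⟩ := hH x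
    exact ⟨_, setOf_le_norm_mem_coboundedSets hh (norm_pos_iff.2 hx), le_refl ‖h x‖⟩
  · rintro B ⟨h, hh, hB⟩
    exact ⟨_, setOf_le_norm_mem_coboundedSets hh one_pos,
      isClosed_le continuous_const h.continuous.norm, hB⟩
  · rintro B ⟨h, hh, hB⟩
    refine ⟨{x | 1 / 2 < ‖h x‖}, ?_, isOpen_lt continuous_const h.continuous.norm, fun x hx => ?_⟩
    · exact (isSetIdeal_coboundedSets H).2.1 _ {x | 1 / 2 ≤ ‖h x‖}
        (fun x hx => le_of_lt (show 1 / 2 < ‖h x‖ from hx))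
        (setOf_le_norm_mem_coboundedSets hh one_half_pos)
    · exact lt_of_lt_of_le one_half_lt_one (hB x hx)

theorem exists_mem_vanishingIdeal_one_le_norm {X : Type*} [TopologicalSpace X] [NormalSpace X]
    {𝔅 : Set (Set X)} (h𝔅 : IsClosedOpenBornology 𝔅) {B : Set X} (hB : B ∈ 𝔅) :
    ∃ f ∈ vanishingIdeal 𝔅 h𝔅.1, ∀ x ∈ B, 1 ≤ ‖f x‖ := by
  obtain ⟨C, hC, hCc, hBC⟩ := h𝔅.2.2.1 B hB
  obtain ⟨U, hU, hUo, hCU⟩ := h𝔅.2.2.2 C hC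
  obtain ⟨u, hu0, hu1, hu⟩ := exists_continuous_zero_one_of_isClosed hUo.isClosed_compl hCc
    (disjoint_compl_left_iff_subset.2 hCU)
  refine ⟨BoundedContinuousFunction.ofNormedAddCommGroup (fun x => (u x : ℂ))
    (Complex.continuous_ofReal.comp u.continuous) 1 fun x => ?_, fun ε hε => ?_, fun x hx => ?_⟩
  · rw [Complex.norm_real, Real.norm_of_nonneg (hu x).1]
    exact (hu x).2
  · refine h𝔅.1.2.1 _ U (fun x hx => ?_) hU
    by_contra hxU
    have hle : ε ≤ ‖(u x : ℂ)‖ := hx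
    rw [hu0 hxU] at hle
    simp only [Pi.zero_apply, Complex.ofReal_zero, norm_zero] at hle
    exact hε.not_ge hle
  · simp [hu1 (hBC hx)]

theorem coboundedSets_vanishingIdeal {X : Type*} [TopologicalSpace X] [NormalSpace X]
    {𝔅 : Set (Set X)} (h𝔅 : IsClosedOpenBornology 𝔅) :
    coboundedSets (vanishingIdeal 𝔅 h𝔅.1) = 𝔅 := by
  refine Subset.antisymm ?_ fun B hB => exists_mem_vanishingIdeal_one_le_norm h𝔅 hB
  rintro B ⟨h, hh, hB⟩
  exact h𝔅.1.2.1 _ _ hB (hh 1 one_pos)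

theorem vanishingIdeal_coboundedSets {X : Type*} [TopologicalSpace X] {H : Ideal (X →ᵇ ℂ)}
    (hH : IsClosed (H : Set (X →ᵇ ℂ))) :
    vanishingIdeal (coboundedSets H) (isSetIdeal_coboundedSets H) = H := by
  refine le_antisymm (fun f hf => ?_) fun f hf ε hε => setOf_le_norm_mem_coboundedSets hf hε
  refine hH.closure_subset (Metric.mem_closure_iff.2 fun ε hε => ?_)
  obtain ⟨h, hh, hlarge⟩ := hf (ε / 2) (half_pos hε)
  have hmax : ∀ x, 0 < max 1 (‖h x‖ ^ 2) := fun x => lt_max_of_lt_left one_pos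
  let m : X →ᵇ ℂ := BoundedContinuousFunction.ofNormedAddCommGroup
    (fun x => (((max 1 (‖h x‖ ^ 2))⁻¹ : ℝ) : ℂ))
    (Complex.continuous_ofReal.comp
      ((continuous_const.max (h.continuous.norm.pow 2)).inv₀ fun x => (hmax x).ne')) 1 fun x => by
        rw [Complex.norm_real, Real.norm_of_nonneg (inv_nonneg.2 (hmax x).le)]
        exact inv_le_one_of_one_le₀ (le_max_left _ _)
  refine ⟨f * m * star h * h, H.mul_mem_left _ hh, lt_of_le_of_lt ?_ (half_lt_self hε)⟩
  refine (BoundedContinuousFunction.dist_le (half_pos hε).le).2 fun x => ?_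
  have hval : f x - (f * m * star h * h) x =
      f x * ((1 - (max 1 (‖h x‖ ^ 2))⁻¹ * ‖h x‖ ^ 2 : ℝ) : ℂ) := by
    have hm : m x = (((max 1 (‖h x‖ ^ 2))⁻¹ : ℝ) : ℂ) := rfl
    simp only [BoundedContinuousFunction.mul_apply, BoundedContinuousFunction.star_apply, hm]
    rw [mul_assoc, RCLike.star_def, Complex.conj_mul']
    push_cast
    ring
  rw [dist_eq_norm, hval, norm_mul, Complex.norm_real]
  rcases le_or_gt (ε / 2) ‖f x‖ with hx | hx
  · have hone : 1 ≤ ‖h x‖ ^ 2 := one_le_pow₀ (hlarge x hx)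
    rw [max_eq_right hone, inv_mul_cancel₀ (by positivity), sub_self, norm_zero, mul_zero]
    exact (half_pos hε).le
  · have hle : (max 1 (‖h x‖ ^ 2))⁻¹ * ‖h x‖ ^ 2 ≤ 1 := by
      rw [inv_mul_le_one₀ (hmax x)]
      exact le_max_right _ _
    have hnonneg : 0 ≤ (max 1 (‖h x‖ ^ 2))⁻¹ * ‖h x‖ ^ 2 :=
      mul_nonneg (inv_nonneg.2 (hmax x).le) (sq_nonneg _)
    rw [Real.norm_of_nonneg (sub_nonneg.2 hle)]
    nlinarith [norm_nonneg (f x)]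

theorem stmt_16 {X : Type*} [TopologicalSpace X] [NormalSpace X] [T2Space X] :
    Nonempty
      ({𝔅 : Set (Set X) // IsClosedOpenBornology 𝔅} ≃o
        {H : Ideal (X →ᵇ ℂ) //
          IsClosed (H : Set (X →ᵇ ℂ)) ∧ ∀ x : X, ∃ h ∈ H, h x ≠ 0}) := by
  refine ⟨Equiv.toOrderIso
    { toFun := fun 𝔅 => ⟨vanishingIdeal 𝔅.1 𝔅.2.1, isClosed_vanishingIdeal 𝔅.2.1, fun x => ?_⟩
      invFun := fun H => ⟨coboundedSets H.1, isClosedOpenBornology_coboundedSets H.2.2⟩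
      left_inv := fun 𝔅 => Subtype.ext (coboundedSets_vanishingIdeal 𝔅.2)
      right_inv := fun H => Subtype.ext (vanishingIdeal_coboundedSets H.2.1) } ?_ ?_⟩
  · obtain ⟨B, hB, hx⟩ : x ∈ ⋃₀ 𝔅.1 := 𝔅.2.2.1 ▸ mem_univ x
    obtain ⟨f, hf, hfB⟩ := exists_mem_vanishingIdeal_one_le_norm 𝔅.2 hB
    exact ⟨f, hf, norm_pos_iff.1 (one_pos.trans_le (hfB x hx))⟩
  · exact fun 𝔅 𝔅' hle f hf ε hε => hle (hf ε hε)
  · rintro H H' hle B ⟨h, hh, hB⟩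
    exact ⟨h, hle hh, hB⟩
end
end

section
/- Let X be a paracompact Hausdorff space in which every point has a Lindelöf neighborhood, and let C_L(X) = {f ∈ C_B(X) : supp(f) is Lindelöf} and Y = ⋃{ cl_{βX}L : L ⊆ X is Lindelöf } ⊆ βX. Then: (a) C_L(X) is a closed ideal of C_B(X); (b) Y is an open subspace of βX (hence locally compact Hausdorff) containing X as a dense subspace, and C_L(X) is isometrically isomorphic to C_0(Y); (c) Y is countably compact and C_0(Y) = C_00(Y); (d) the following are equivalent: Y is normal; Y is compact; X is Lindelöf; C_L(X) has a multiplicative unit. -/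
open Set Filter Topology BoundedContinuousFunction

noncomputable section

/-- `C_L(X)`: bounded continuous functions with Lindelöf support. -/
def CL (X : Type*) [TopologicalSpace X] : Set (X →ᵇ ℂ) :=
  {f | IsLindelof (closure {x : X | f x ≠ 0})}

/-- `Y = ⋃ { cl_{βX} L : L ⊆ X Lindelöf }`. -/
def Yset (X : Type*) [TopologicalSpace X] : Set (StoneCech X) :=
  ⋃ L ∈ {L : Set X | IsLindelof L}, closure (stoneCechUnit '' L)

/-- A set is countably compact if every countable open cover of it has a finite subcover. -/
def IsCountablyCompactSet {α : Type*} [TopologicalSpace α] (s : Set α) : Prop :=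
  ∀ U : ℕ → Set α, (∀ n, IsOpen (U n)) → s ⊆ ⋃ n, U n → ∃ t : Finset ℕ, s ⊆ ⋃ n ∈ t, U n

universe u

lemma IsLindelof.countable_setOf_inter_nonempty {X ι : Type*} [TopologicalSpace X]
    {v : ι → Set X} (hv : LocallyFinite v) {L : Set X} (hL : IsLindelof L) :
    {i | (v i ∩ L).Nonempty}.Countable := by
  choose W hW hfin using hv
  obtain ⟨t, ht, hcov⟩ := hL.elim_nhds_subcover W fun x _ => hW x
  refine (ht.biUnion fun x _ => (hfin x).countable).mono ?_
  rintro i ⟨x, hxi, hxL⟩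
  obtain ⟨y, hy, hxy⟩ := mem_iUnion₂.1 (hcov.2 hxL)
  exact mem_iUnion₂.2 ⟨y, hy, x, hxi, hxy⟩

lemma Relation.countable_setOf_reflTransGen {α : Type*} {r : α → α → Prop}
    (h : ∀ a, {b | r a b}.Countable) (a : α) :
    {b | Relation.ReflTransGen r a b}.Countable := by
  let S : ℕ → Set α := fun n => Nat.rec {a} (fun _ s => ⋃ b ∈ s, {c | r b c}) n
  have hS : ∀ n, (S n).Countable := by
    intro n
    induction n with
    | zero => exact countable_singleton a
    | succ n ih => exact ih.biUnion fun b _ => h b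
  refine (countable_iUnion hS).mono fun b hb => ?_
  induction hb with
  | refl => exact mem_iUnion.2 ⟨0, rfl⟩
  | tail _ hbc ih =>
    obtain ⟨n, hn⟩ := mem_iUnion.1 ih
    exact mem_iUnion.2 ⟨n + 1, mem_iUnion₂.2 ⟨_, hn, hbc⟩⟩

/-- A paracompact Hausdorff locally Lindelöf space is a disjoint union of clopen Lindelöf
subspaces. -/
lemma exists_isLocallyConstant_isLindelof_fiber {X : Type*} [TopologicalSpace X]
    [ParacompactSpace X] [T2Space X] (hloc : ∀ x : X, ∃ L ∈ 𝓝 x, IsLindelof L) :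
    ∃ c : X → Set X, IsLocallyConstant c ∧ ∀ i, IsLindelof (c ⁻¹' {i}) := by
  have hU : ∀ x : X, ∃ U : Set X, IsOpen U ∧ x ∈ U ∧ IsLindelof (closure U) := by
    intro x
    obtain ⟨L, hLx, hL⟩ := hloc x
    obtain ⟨C, ⟨hCx, hC⟩, hCL⟩ := (closed_nhds_basis x).mem_iff.1 hLx
    exact ⟨interior C, isOpen_interior, mem_interior_iff_mem_nhds.2 hCx,
      hL.of_isClosed_subset isClosed_closure
        ((closure_minimal interior_subset hC).trans hCL)⟩
  choose U hUo hxU hUL using hU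
  obtain ⟨v, hvo, hvc, hvf, hvU⟩ := precise_refinement U hUo
    (iUnion_eq_univ_iff.2 fun x => ⟨x, hxU x⟩)
  have hvL : ∀ i, IsLindelof (closure (v i)) := fun i =>
    (hUL i).of_isClosed_subset isClosed_closure (closure_mono (hvU i))
  choose k hk using iUnion_eq_univ_iff.1 hvc
  let r : X → X → Prop := fun i j => (v i ∩ v j).Nonempty
  have hr : ∀ i, {j | r i j}.Countable := fun i =>
    (IsLindelof.countable_setOf_inter_nonempty hvf (hvL i)).mono <| by
      rintro j ⟨x, hxi, hxj⟩
      exact ⟨x, hxj, subset_closure hxi⟩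
  have hsymm : Std.Symm r := ⟨fun i j ⟨x, hxi, hxj⟩ => ⟨x, hxj, hxi⟩⟩
  let c : X → Set X := fun x => {j | Relation.ReflTransGen r (k x) j}
  have hc : IsLocallyConstant c := by
    refine (IsLocallyConstant.iff_exists_open c).2 fun x =>
      ⟨v (k x), hvo _, hk x, fun y hy => ?_⟩
    have hxy : r (k x) (k y) := ⟨y, hy, hk y⟩
    ext j
    exact ⟨fun h => Relation.ReflTransGen.head hxy h,
      fun h => Relation.ReflTransGen.head (hsymm.symm _ _ hxy) h⟩
  refine ⟨c, hc, fun i => ?_⟩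
  rcases (c ⁻¹' {i}).eq_empty_or_nonempty with he | ⟨x, rfl⟩
  · rw [he]
    exact isLindelof_empty
  · refine ((Relation.countable_setOf_reflTransGen hr (k x)).isLindelof_biUnion
      fun j _ => hvL j).of_isClosed_subset (hc.isClosed_fiber _) fun y hy => ?_
    refine mem_iUnion₂.2 ⟨k y, ?_, subset_closure (hk y)⟩
    have : k y ∈ c y := Relation.ReflTransGen.refl
    rw [show c y = c x from hy] at this
    exact this

lemma IsLocallyConstant.countable_image_of_isLindelof {X ι : Type*} [TopologicalSpace X]
    {c : X → ι} (hc : IsLocallyConstant c) {L : Set X} (hL : IsLindelof L) :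
    (c '' L).Countable := by
  let _ : TopologicalSpace ι := ⊥
  have : DiscreteTopology ι := ⟨rfl⟩
  exact (hL.image hc.continuous).countable_of_discrete

/-- In a paracompact Hausdorff locally Lindelöf space every Lindelöf set lies in a clopen
Lindelöf set. -/
lemma IsLindelof.exists_isClopen_superset {X : Type*} [TopologicalSpace X]
    [ParacompactSpace X] [T2Space X] (hloc : ∀ x : X, ∃ L ∈ 𝓝 x, IsLindelof L)
    {L : Set X} (hL : IsLindelof L) :
    ∃ M : Set X, IsClopen M ∧ IsLindelof M ∧ L ⊆ M := by
  obtain ⟨c, hc, hcL⟩ := exists_isLocallyConstant_isLindelof_fiber hloc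
  refine ⟨c ⁻¹' (c '' L), ⟨⟨?_⟩, hc _⟩, ?_, subset_preimage_image c L⟩
  · exact hc (c '' L)ᶜ
  · rw [← biUnion_preimage_singleton]
    exact (hc.countable_image_of_isLindelof hL).isLindelof_biUnion fun i _ => hcL i

/-- A non-Lindelöf paracompact Hausdorff locally Lindelöf space maps continuously onto every
discrete space of cardinality at most `ℵ₁`. -/
lemma exists_isLocallyConstant_surjective {X T : Type u} [TopologicalSpace X]
    [ParacompactSpace X] [T2Space X] (hloc : ∀ x : X, ∃ L ∈ 𝓝 x, IsLindelof L)
    (hX : ¬ IsLindelof (univ : Set X)) [Nonempty T] (hT : Cardinal.mk T ≤ Cardinal.aleph 1) :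
    ∃ φ : X → T, IsLocallyConstant φ ∧ Function.Surjective φ := by
  obtain ⟨c, hc, hcL⟩ := exists_isLocallyConstant_isLindelof_fiber hloc
  have hcard : Cardinal.mk T ≤ Cardinal.mk (range c) := by
    refine hT.trans (not_lt.1 fun h => hX ?_)
    rw [Cardinal.lt_aleph_one_iff, Cardinal.le_aleph0_iff_set_countable] at h
    rw [← preimage_range c, ← biUnion_preimage_singleton]
    exact h.isLindelof_biUnion fun i _ => hcL i
  obtain ⟨e⟩ := (Cardinal.le_def _ _).1 hcard
  refine ⟨fun x => Function.invFun e (rangeFactorization c x), ?_, ?_⟩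
  · refine (IsLocallyConstant.iff_exists_open _).2 fun x => ?_
    obtain ⟨U, hU, hx, hUc⟩ := hc.exists_open x
    refine ⟨U, hU, hx, fun y hy => ?_⟩
    congr 1
    exact Subtype.ext (hUc y hy)
  · exact (Function.invFun_surjective e.injective).comp rangeFactorization_surjective

lemma exists_linearOrder_aleph_one : ∃ (Ω : Type u) (_ : LinearOrder Ω),
    Cardinal.mk Ω = Cardinal.aleph 1 ∧ ∀ s : Set Ω, s.Countable → ∃ b, ∀ a ∈ s, a < b := by
  refine ⟨(Cardinal.aleph.{u} 1).ord.ToType, inferInstance, by simp, fun s hs => ?_⟩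
  by_contra! h
  have hcount : (⋃ a ∈ s, Set.Iic a).Countable := by
    refine hs.biUnion fun a _ => ?_
    rw [← Set.Iio_insert]
    refine Set.Countable.insert _ ?_
    rw [← Cardinal.le_aleph0_iff_set_countable, ← Cardinal.lt_aleph_one_iff]
    exact (Cardinal.mk_Iio_lt a (by simp)).trans_eq (by simp)
  have huniv : (⋃ a ∈ s, Set.Iic a) = univ :=
    eq_univ_of_forall fun b => by
      obtain ⟨a, ha, hba⟩ := h b
      exact mem_iUnion₂.2 ⟨a, ha, hba⟩
  rw [huniv, ← Cardinal.le_aleph0_iff_set_countable, Cardinal.mk_univ] at hcount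
  simp at hcount

/-- A set of cardinality at most the continuum carries countably many subsets which cut out every
subset of every finite set. -/
lemma exists_seq_set_shattering {Ω : Type u} (h : Cardinal.mk Ω ≤ Cardinal.continuum) :
    ∃ d : ℕ → Set Ω, ∀ (F : Finset Ω) (A : Set Ω), ∃ n, ∀ ξ ∈ F, ξ ∈ d n ↔ ξ ∈ A := by
  classical
  have h' : Cardinal.lift.{0} (Cardinal.mk Ω) ≤ Cardinal.lift.{u} (Cardinal.mk ℝ) := by
    simpa [Cardinal.mk_real] using h
  obtain ⟨r⟩ := Cardinal.lift_mk_le'.1 h'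
  let B := TopologicalSpace.countableBasis ℝ
  have : Countable B := (TopologicalSpace.countable_countableBasis ℝ).to_subtype
  obtain ⟨e, he⟩ := exists_surjective_nat (Finset B)
  refine ⟨fun n => {ξ | ∃ b ∈ e n, r ξ ∈ (b : Set ℝ)}, fun F A => ?_⟩
  have hb : ∀ ξ : Ω, ∃ b : B, r ξ ∈ (b : Set ℝ) ∧ ∀ η ∈ F, r η ∈ (b : Set ℝ) → η = ξ := by
    intro ξ
    have hopen : IsOpen ((F.erase ξ).image r : Set ℝ)ᶜ :=
      (Finset.finite_toSet _).isClosed.isOpen_compl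
    obtain ⟨b, hbB, hξb, hbs⟩ :=
      (TopologicalSpace.isBasis_countableBasis ℝ).exists_subset_of_mem_open
        (a := r ξ) (by simp) hopen
    refine ⟨⟨b, hbB⟩, hξb, fun η hη hηb => ?_⟩
    by_contra hne
    exact hbs hηb (by simpa using ⟨hη, hne⟩)
  choose b hbξ hbF using hb
  obtain ⟨n, hn⟩ := he ((F.filter (· ∈ A)).image b)
  refine ⟨n, fun ξ hξ => ?_⟩
  simp only [mem_ofPred_eq, hn, Finset.mem_image, Finset.mem_filter]
  constructor
  · rintro ⟨_, ⟨η, ⟨-, hηA⟩, rfl⟩, hξb⟩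
    exact hbF η ξ hξ hξb ▸ hηA
  · exact fun hA => ⟨_, ⟨ξ, ⟨hξ, hA⟩, rfl⟩, hbξ ξ⟩

lemma IsClopen.exists_stoneCech_preimage {X : Type*} [TopologicalSpace X] {A : Set X}
    (hA : IsClopen A) :
    ∃ P : Set (StoneCech X), IsClopen P ∧ ∀ x, stoneCechUnit x ∈ P ↔ x ∈ A := by
  classical
  have hf : Continuous fun x => decide (x ∈ A) := by
    refine (IsLocallyConstant.iff_exists_open _).2 (fun x => ?_) |>.continuous
    by_cases hx : x ∈ A
    · exact ⟨A, hA.isOpen, hx, fun y hy => by simp [hx, hy]⟩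
    · exact ⟨Aᶜ, hA.compl.isOpen, hx, fun y hy => by simpa [hx] using hy⟩
  refine ⟨stoneCechExtend hf ⁻¹' {true},
    (isClopen_discrete _).preimage (continuous_stoneCechExtend hf), fun x => ?_⟩
  simp [stoneCechExtend_stoneCechUnit]

lemma closure_image_stoneCechUnit_eq {X : Type*} [TopologicalSpace X] {A : Set X}
    {P : Set (StoneCech X)} (hP : IsClopen P) (hPA : ∀ x, stoneCechUnit x ∈ P ↔ x ∈ A) :
    closure (stoneCechUnit '' A) = P := by
  have h : stoneCechUnit '' A = P ∩ range stoneCechUnit := by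
    ext y
    constructor
    · rintro ⟨x, hx, rfl⟩
      exact ⟨(hPA x).2 hx, x, rfl⟩
    · rintro ⟨hy, x, rfl⟩
      exact ⟨x, (hPA x).1 hy, rfl⟩
  rw [h]
  exact (closure_minimal inter_subset_left hP.isClosed).antisymm
    (denseRange_stoneCechUnit.open_subset_closure_inter hP.isOpen)

lemma IsClopen.isClopen_closure_stoneCech {X : Type*} [TopologicalSpace X] {A : Set X}
    (hA : IsClopen A) : IsClopen (closure (stoneCechUnit '' A) : Set (StoneCech X)) := by
  obtain ⟨P, hP, hPA⟩ := hA.exists_stoneCech_preimage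
  rwa [closure_image_stoneCechUnit_eq hP hPA]

lemma IsClopen.stoneCechUnit_mem_closure_iff {X : Type*} [TopologicalSpace X] {A : Set X}
    (hA : IsClopen A) {x : X} :
    (stoneCechUnit x : StoneCech X) ∈ closure (stoneCechUnit '' A) ↔ x ∈ A := by
  obtain ⟨P, hP, hPA⟩ := hA.exists_stoneCech_preimage
  rw [closure_image_stoneCechUnit_eq hP hPA, hPA]

section Yset

variable {X : Type*} [TopologicalSpace X]

lemma IsLindelof.closure_image_subset_Yset {L : Set X} (hL : IsLindelof L) :
    closure (stoneCechUnit '' L) ⊆ Yset X := fun _ hy => mem_iUnion₂.2 ⟨L, hL, hy⟩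

lemma range_stoneCechUnit_subset_Yset : range (stoneCechUnit : X → StoneCech X) ⊆ Yset X := by
  rintro _ ⟨x, rfl⟩
  exact (isLindelof_singleton (x := x)).closure_image_subset_Yset
    (subset_closure (mem_image_of_mem _ rfl))

variable [ParacompactSpace X] [T2Space X]

lemma exists_isClopen_isLindelof_of_mem_Yset (hloc : ∀ x : X, ∃ L ∈ 𝓝 x, IsLindelof L)
    {y : StoneCech X} (hy : y ∈ Yset X) :
    ∃ M : Set X, IsClopen M ∧ IsLindelof M ∧ y ∈ closure (stoneCechUnit '' M) := by
  obtain ⟨L, hL, hyL⟩ := mem_iUnion₂.1 hy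
  obtain ⟨M, hM, hML, hLM⟩ := IsLindelof.exists_isClopen_superset hloc hL
  exact ⟨M, hM, hML, closure_mono (image_mono hLM) hyL⟩

lemma exists_isClopen_isLindelof_iUnion_subset (hloc : ∀ x : X, ∃ L ∈ 𝓝 x, IsLindelof L)
    {ι : Type*} [Countable ι] {L : ι → Set X} (hL : ∀ i, IsLindelof (L i)) :
    ∃ M : Set X, IsClopen M ∧ IsLindelof M ∧ ∀ i, L i ⊆ M := by
  obtain ⟨M, hM, hML, hLM⟩ := IsLindelof.exists_isClopen_superset hloc (isLindelof_iUnion hL)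
  exact ⟨M, hM, hML, fun i => (subset_iUnion L i).trans hLM⟩

lemma isOpen_Yset (hloc : ∀ x : X, ∃ L ∈ 𝓝 x, IsLindelof L) : IsOpen (Yset X) := by
  refine isOpen_iff_mem_nhds.2 fun y hy => ?_
  obtain ⟨M, hM, hML, hyM⟩ := exists_isClopen_isLindelof_of_mem_Yset hloc hy
  exact Filter.mem_of_superset (hM.isClopen_closure_stoneCech.isOpen.mem_nhds hyM)
    hML.closure_image_subset_Yset

lemma IsCompact.exists_isClopen_isLindelof_of_subset_Yset
    (hloc : ∀ x : X, ∃ L ∈ 𝓝 x, IsLindelof L) {K : Set (StoneCech X)} (hK : IsCompact K)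
    (hKY : K ⊆ Yset X) :
    ∃ M : Set X, IsClopen M ∧ IsLindelof M ∧ K ⊆ closure (stoneCechUnit '' M) := by
  choose! M hM hML hyM using
    fun y (hy : y ∈ K) => exists_isClopen_isLindelof_of_mem_Yset hloc (hKY hy)
  obtain ⟨t, htK, ht⟩ := hK.elim_nhds_subcover (fun y => closure (stoneCechUnit '' M y))
    fun y hy => (hM y hy).isClopen_closure_stoneCech.isOpen.mem_nhds (hyM y hy)
  obtain ⟨N, hN, hNL, hMN⟩ := exists_isClopen_isLindelof_iUnion_subset hloc
    (L := fun y : t => M y) fun y => hML y (htK y y.2)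
  exact ⟨N, hN, hNL, ht.trans (iUnion₂_subset fun y hy =>
    closure_mono (image_mono (hMN ⟨y, hy⟩)))⟩

/-- Every σ-compact subset of `Yset X` lies in a single compact clopen piece. -/
lemma exists_isClopen_isLindelof_of_iUnion_isCompact
    (hloc : ∀ x : X, ∃ L ∈ 𝓝 x, IsLindelof L) {K : ℕ → Set (StoneCech X)}
    (hK : ∀ n, IsCompact (K n)) (hKY : ∀ n, K n ⊆ Yset X) :
    ∃ M : Set X, IsClopen M ∧ IsLindelof M ∧ ∀ n, K n ⊆ closure (stoneCechUnit '' M) := by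
  choose M hM hML hKM using
    fun n => (hK n).exists_isClopen_isLindelof_of_subset_Yset hloc (hKY n)
  obtain ⟨N, hN, hNL, hMN⟩ := exists_isClopen_isLindelof_iUnion_subset hloc hML
  exact ⟨N, hN, hNL, fun n => (hKM n).trans (closure_mono (image_mono (hMN n)))⟩

lemma isCountablyCompactSet_Yset (hloc : ∀ x : X, ∃ L ∈ 𝓝 x, IsLindelof L) :
    IsCountablyCompactSet (Yset X) := by
  intro U hU hcov
  by_contra! h
  choose y hyY hyU using fun n : ℕ => not_subset.1 (h (Finset.range n))
  obtain ⟨M, hM, hML, hyM⟩ := exists_isClopen_isLindelof_of_iUnion_isCompact hloc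
    (fun n => isCompact_singleton (x := y n)) (fun n => singleton_subset_iff.2 (hyY n))
  obtain ⟨t, ht⟩ := (isClosed_closure (s := stoneCechUnit '' M)).isCompact.elim_finite_subcover U hU
    (hML.closure_image_subset_Yset.trans hcov)
  obtain ⟨n, hn⟩ := t.exists_nat_subset_range
  exact hyU n (biUnion_mono hn (fun _ _ => Subset.rfl) (ht (hyM n rfl)))

lemma isCompact_Yset_iff (hloc : ∀ x : X, ∃ L ∈ 𝓝 x, IsLindelof L) :
    IsCompact (Yset X) ↔ IsLindelof (univ : Set X) := by
  constructor
  · intro h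
    obtain ⟨M, hM, hML, hYM⟩ := h.exists_isClopen_isLindelof_of_subset_Yset hloc Subset.rfl
    rwa [← eq_univ_of_forall fun x => hM.stoneCechUnit_mem_closure_iff.1
      (hYM (range_stoneCechUnit_subset_Yset (mem_range_self x)))]
  · intro h
    have : Yset X = univ := by
      refine univ_subset_iff.1 (Subset.trans ?_ h.closure_image_subset_Yset)
      rw [image_univ, denseRange_stoneCechUnit.closure_range]
    rw [this]
    exact isCompact_univ

lemma mem_CL_iff (hloc : ∀ x : X, ∃ L ∈ 𝓝 x, IsLindelof L) {f : X →ᵇ ℂ} :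
    f ∈ CL X ↔ ∃ L : Set X, IsLindelof L ∧ ∀ x ∉ L, f x = 0 := by
  constructor
  · exact fun h => ⟨_, h, fun x hx => not_not.1 fun h => hx (subset_closure h)⟩
  · rintro ⟨L, hL, hf⟩
    obtain ⟨M, hM, hML, hLM⟩ := IsLindelof.exists_isClopen_superset hloc hL
    exact hML.of_isClosed_subset isClosed_closure (closure_minimal
      (fun x hx => hLM (not_not.1 fun h => hx (hf x h))) hM.isClosed)

lemma exists_ideal_eq_CL (hloc : ∀ x : X, ∃ L ∈ 𝓝 x, IsLindelof L) :
    ∃ I : Ideal (X →ᵇ ℂ), (I : Set (X →ᵇ ℂ)) = CL X := by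
  refine ⟨{ carrier := CL X, add_mem' := ?_, zero_mem' := ?_, smul_mem' := ?_ }, rfl⟩
  · intro f g hf hg
    obtain ⟨L, hL, hfL⟩ := (mem_CL_iff hloc).1 hf
    obtain ⟨L', hL', hgL⟩ := (mem_CL_iff hloc).1 hg
    exact (mem_CL_iff hloc).2 ⟨L ∪ L', hL.union hL', fun x hx => by
      simp [hfL x fun h => hx (Or.inl h), hgL x fun h => hx (Or.inr h)]⟩
  · exact (mem_CL_iff hloc).2 ⟨∅, isLindelof_empty, fun x _ => rfl⟩
  · intro c f hf
    obtain ⟨L, hL, hfL⟩ := (mem_CL_iff hloc).1 hf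
    exact (mem_CL_iff hloc).2 ⟨L, hL, fun x hx => by simp [hfL x hx]⟩

lemma isClosed_CL (hloc : ∀ x : X, ∃ L ∈ 𝓝 x, IsLindelof L) : IsClosed (CL X) := by
  refine IsSeqClosed.isClosed fun f g hf hfg => ?_
  choose L hL hfL using fun n => (mem_CL_iff hloc).1 (hf n)
  refine (mem_CL_iff hloc).2 ⟨⋃ n, L n, isLindelof_iUnion hL, fun x hx => ?_⟩
  have hx' : ∀ n, f n x = 0 := fun n => hfL n x fun h => hx (mem_iUnion.2 ⟨n, h⟩)
  have hlim : Tendsto (fun n => f n x) atTop (𝓝 (g x)) :=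
    ((continuous_eval_const (F := X →ᵇ ℂ) x).tendsto g).comp hfg
  simp only [hx'] at hlim
  exact tendsto_nhds_unique hlim tendsto_const_nhds

lemma isLindelof_univ_iff_exists_unit (hloc : ∀ x : X, ∃ L ∈ 𝓝 x, IsLindelof L) :
    IsLindelof (univ : Set X) ↔ ∃ u ∈ CL X, ∀ f ∈ CL X, u * f = f := by
  classical
  constructor
  · exact fun h => ⟨1, (mem_CL_iff hloc).2 ⟨univ, h, fun x hx => absurd (mem_univ x) hx⟩,
      fun f _ => one_mul f⟩
  · rintro ⟨u, hu, huf⟩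
    obtain ⟨L, hL, huL⟩ := (mem_CL_iff hloc).1 hu
    suffices L = univ by rwa [← this]
    refine eq_univ_of_forall fun x => not_not.1 fun hx => ?_
    obtain ⟨M, hM, hML, hxM⟩ :=
      IsLindelof.exists_isClopen_superset hloc (isLindelof_singleton (x := x))
    have hcont : Continuous (M.indicator (1 : X → ℂ)) := continuous_one.indicator fun y hy => by
      simp [hM.frontier_eq] at hy
    let f : X →ᵇ ℂ := BoundedContinuousFunction.ofNormedAddCommGroup
      (M.indicator (1 : X → ℂ)) hcont 1 fun y => by
        by_cases hy : y ∈ M <;> simp [hy]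
    have hf : f ∈ CL X := (mem_CL_iff hloc).2
      ⟨M, hML, fun y hy => indicator_of_notMem hy _⟩
    have h1 : u x * f x = f x := congrArg (fun g : X →ᵇ ℂ => g x) (huf f hf)
    have h2 : f x = 1 := indicator_of_mem (hxM rfl) _
    simp [huL x hx, h2] at h1

end Yset

/-- If `X` is not Lindelöf then `Yset X` is not normal. The graph of the order embedding of `ℵ₁`
into `2 ^ ℵ₁` and the constant `1` section are closed sets in `Yset X` that cannot be separated. -/
lemma not_normalSpace_Yset {X : Type u} [TopologicalSpace X] [ParacompactSpace X] [T2Space X]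
    (hloc : ∀ x : X, ∃ L ∈ 𝓝 x, IsLindelof L) (hX : ¬ IsLindelof (univ : Set X)) :
    ¬ NormalSpace (Yset X) := by
  classical
  intro hnormal
  obtain ⟨Ω, _, hΩ, hbdd⟩ := exists_linearOrder_aleph_one.{u}
  obtain ⟨d, hd⟩ := exists_seq_set_shattering (hΩ.trans_le Cardinal.aleph_one_le_continuum)
  have : Nonempty Ω := (hbdd ∅ countable_empty).nonempty
  obtain ⟨φ, hφ, hφs⟩ := exists_isLocallyConstant_surjective (T := Ω × ℕ) hloc hX (by simp [hΩ])
  have hclopen : ∀ S : Set (Ω × ℕ), IsClopen (φ ⁻¹' S) := fun S => ⟨⟨hφ Sᶜ⟩, hφ S⟩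
  choose p hp hpX using fun ξ : Ω => (hclopen {t | ξ < t.1}).exists_stoneCech_preimage
  choose q hq hqX using fun ξ : Ω => (hclopen {t | ξ ∈ d t.2}).exists_stoneCech_preimage
  choose x hx using fun (α : Ω) (n : ℕ) => hφs (α, n)
  have hbound : ∀ y ∈ Yset X, ∃ ξ, y ∉ p ξ := by
    intro y hy
    obtain ⟨L, hL, hyL⟩ := mem_iUnion₂.1 hy
    obtain ⟨b, hb⟩ := hbdd _ ((hφ.countable_image_of_isLindelof hL).image Prod.fst)
    refine ⟨b, closure_minimal ?_ (hp b).compl.isClosed hyL⟩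
    rintro _ ⟨t, ht, rfl⟩ htp
    exact lt_asymm ((hpX b t).1 htp) (hb _ (mem_image_of_mem _ (mem_image_of_mem _ ht)))
  have hiff : ∀ ξ, IsClosed {y | y ∈ p ξ ↔ y ∈ q ξ} := by
    intro ξ
    have : {y | y ∈ p ξ ↔ y ∈ q ξ} = (p ξ ∩ q ξ) ∪ ((p ξ)ᶜ ∩ (q ξ)ᶜ) := by
      ext y
      simp only [mem_ofPred_eq, mem_union, mem_inter_iff, mem_compl_iff]
      tauto
    rw [this]
    exact (((hp ξ).inter (hq ξ)).union ((hp ξ).compl.inter (hq ξ).compl)).isClosed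
  let H : Set (StoneCech X) := ⋂ ξ, {y | y ∈ p ξ ↔ y ∈ q ξ}
  let K : Set (StoneCech X) := ⋂ ξ, q ξ
  have hH : IsClosed H := isClosed_iInter hiff
  have hK : IsClosed K := isClosed_iInter fun ξ => (hq ξ).isClosed
  obtain ⟨U₀, V₀, hU₀, hV₀, hHU, hKV, hUV⟩ := normal_separation
    (hH.preimage (continuous_subtype_val (p := (· ∈ Yset X))))
    (hK.preimage (continuous_subtype_val (p := (· ∈ Yset X)))) (by
      refine disjoint_left.2 fun y hyH hyK => ?_
      obtain ⟨ξ, hξ⟩ := hbound y y.2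
      exact hξ ((mem_iInter.1 hyH ξ).2 (mem_iInter.1 hyK ξ)))
  let U : Set (StoneCech X) := Subtype.val '' U₀
  let V : Set (StoneCech X) := Subtype.val '' V₀
  have hU : IsOpen U := (isOpen_Yset hloc).isOpenMap_subtype_val _ hU₀
  have hV : IsOpen V := (isOpen_Yset hloc).isOpenMap_subtype_val _ hV₀
  have hdisj : Disjoint U V := (disjoint_image_iff Subtype.val_injective).2 hUV
  let Z : Ω → Set (StoneCech X) := fun α => closure (stoneCechUnit '' range (x α))
  have hZY : ∀ α, Z α ⊆ Yset X := fun α =>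
    (countable_range (x α)).isLindelof.closure_image_subset_Yset
  have hZp : ∀ α, ∀ y ∈ Z α, ∀ ξ, y ∈ p ξ ↔ ξ < α := by
    intro α y hy ξ
    by_cases h : ξ < α
    · refine iff_of_true (closure_minimal ?_ (hp ξ).isClosed hy) h
      rintro _ ⟨_, ⟨n, rfl⟩, rfl⟩
      exact (hpX ξ _).2 (by simpa [hx] using h)
    · refine iff_of_false (closure_minimal ?_ (hp ξ).compl.isClosed hy) h
      rintro _ ⟨_, ⟨n, rfl⟩, rfl⟩ hmem
      exact h (by simpa [hx] using (hpX ξ _).1 hmem)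
  have hF : ∀ α, ∃ F : Finset Ω, ∀ y ∈ Z α, (∀ ξ ∈ F, y ∈ q ξ) → y ∈ V := by
    intro α
    obtain ⟨F, hF⟩ := (isClosed_closure.isCompact.diff hV :
      IsCompact (Z α \ V)).elim_finite_subfamily_closed q (fun ξ => (hq ξ).isClosed) (by
        refine disjoint_iff_inter_eq_empty.1 (disjoint_left.2 fun y hy hyK => hy.2 ?_)
        exact ⟨⟨y, hZY α hy.1⟩, hKV hyK, rfl⟩)
    refine ⟨F, fun y hy hyF => by_contra fun hyV => ?_⟩
    exact (eq_empty_iff_forall_notMem.1 hF) y ⟨⟨hy, hyV⟩, mem_iInter₂.2 hyF⟩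
  choose F hF using hF
  have hnext : ∀ α, ∃ β, α < β ∧ ∀ ξ ∈ F α, ξ < β := fun α => by
    obtain ⟨β, hβ⟩ := hbdd _ (insert α (F α)).countable_toSet
    exact ⟨β, hβ α (by simp), fun ξ hξ => hβ ξ (by simp [hξ])⟩
  choose next hlt hFnext using hnext
  let a : ℕ → Ω := fun n => next^[n] (Classical.arbitrary Ω)
  have ha : ∀ n, a (n + 1) = next (a n) := fun n => Function.iterate_succ_apply' next n _
  have hamono : StrictMono a := strictMono_nat_of_lt_succ fun n => ha n ▸ hlt (a n)
  have hz : ∀ n, ∃ z ∈ Z (a n), ∀ ξ, z ∈ q ξ ↔ ξ < a (n + 1) := by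
    intro n
    have hclosed : ∀ ξ, IsClosed {y | y ∈ q ξ ↔ ξ < a (n + 1)} := fun ξ => by
      by_cases h : ξ < a (n + 1)
      · simpa [h] using (hq ξ).isClosed
      · simp only [h, iff_false]
        exact (hq ξ).compl.isClosed
    obtain ⟨z, hzZ, hz⟩ := (isClosed_closure.isCompact : IsCompact (Z (a n))).inter_iInter_nonempty
      _ hclosed (by
        intro G
        obtain ⟨m, hm⟩ := hd G (Iio (a (n + 1)))
        refine ⟨stoneCechUnit (x (a n) m), subset_closure ⟨_, mem_range_self m, rfl⟩,
          mem_iInter₂.2 fun ξ hξ => (hqX ξ _).trans ?_⟩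
        simpa [hx] using hm ξ hξ)
    exact ⟨z, hzZ, mem_iInter.1 hz⟩
  choose z hzZ hzq using hz
  have hzV : ∀ n, z n ∈ V := fun n => hF (a n) _ (hzZ n) fun ξ hξ =>
    (hzq n ξ).2 (ha n ▸ hFnext (a n) ξ hξ)
  have hcount : (⋃ n, range (x (a n))).Countable := countable_iUnion fun n => countable_range _
  obtain ⟨w, hwC, hw⟩ := (isClosed_closure.isCompact :
    IsCompact (closure (stoneCechUnit '' ⋃ n, range (x (a n))))).exists_mapClusterPt_of_frequently
      (l := atTop) (f := z) (by
        refine Eventually.frequently (Eventually.of_forall fun n => ?_)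
        exact closure_mono (image_mono (subset_iUnion (fun n => range (x (a n))) n)) (hzZ n))
  have hwH : w ∈ H := by
    refine mem_iInter.2 fun ξ => ?_
    by_cases h : ∃ k, ξ < a k
    · obtain ⟨k, hk⟩ := h
      refine iff_of_true ((hp ξ).isClosed.mem_of_mapClusterPt hw ?_)
        ((hq ξ).isClosed.mem_of_mapClusterPt hw ?_)
      · filter_upwards [eventually_ge_atTop k] with n hn
        exact (hZp _ _ (hzZ n) ξ).2 (hk.trans_le (hamono.monotone hn))
      · filter_upwards [eventually_ge_atTop k] with n hn
        exact (hzq n ξ).2 (hk.trans_le (hamono.monotone (hn.trans n.le_succ)))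
    · push Not at h
      refine iff_of_false ((hp ξ).compl.isClosed.mem_of_mapClusterPt hw ?_)
        ((hq ξ).compl.isClosed.mem_of_mapClusterPt hw ?_)
      · exact Eventually.of_forall fun n hn => (h n).not_gt ((hZp _ _ (hzZ n) ξ).1 hn)
      · exact Eventually.of_forall fun n hn => (h (n + 1)).not_gt ((hzq n ξ).1 hn)
  have hwU : w ∈ U :=
    ⟨⟨w, hcount.isLindelof.closure_image_subset_Yset hwC⟩, hHU hwH, rfl⟩
  obtain ⟨n, hn⟩ := (hw.frequently (hU.mem_nhds hwU)).exists
  exact disjoint_left.1 hdisj hn (hzV n)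

lemma BoundedContinuousFunction.exists_stoneCech_extension {X : Type*} [TopologicalSpace X]
    (f : X →ᵇ ℂ) : ∃ F : C(StoneCech X, ℂ), ∀ x, F (stoneCechUnit x) = f x := by
  have hf : Continuous fun x => (⟨f x, mem_closedBall_zero_iff.2 (f.norm_coe_le_norm x)⟩ :
      Metric.closedBall (0 : ℂ) ‖f‖) := f.continuous.subtype_mk _
  have : CompactSpace (Metric.closedBall (0 : ℂ) ‖f‖) :=
    isCompact_iff_compactSpace.1 (isCompact_closedBall _ _)
  exact ⟨⟨fun y => (stoneCechExtend hf y : Metric.closedBall (0 : ℂ) ‖f‖),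
    continuous_subtype_val.comp (continuous_stoneCechExtend hf)⟩,
    fun x => congrArg Subtype.val (stoneCechExtend_stoneCechUnit hf x)⟩

section ContinuousOnYset

variable {X : Type*} [TopologicalSpace X]

/-- The canonical map of `X` into `Yset X`. -/
def toYset (x : X) : Yset X :=
  ⟨stoneCechUnit x, range_stoneCechUnit_subset_Yset (mem_range_self x)⟩

lemma continuous_toYset : Continuous (toYset : X → Yset X) :=
  continuous_stoneCechUnit.subtype_mk _

lemma isCompact_preimage_val_closure {L : Set X} (hL : IsLindelof L) :
    IsCompact (Subtype.val ⁻¹' closure (stoneCechUnit '' L) : Set (Yset X)) := by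
  rw [Subtype.isCompact_iff, Subtype.image_preimage_coe,
    inter_eq_right.2 hL.closure_image_subset_Yset]
  exact isClosed_closure.isCompact

variable [ParacompactSpace X] [T2Space X]

lemma denseRange_toYset (hloc : ∀ x : X, ∃ L ∈ 𝓝 x, IsLindelof L) :
    DenseRange (toYset : X → Yset X) := by
  refine dense_iff_inter_open.2 fun U hU ⟨y, hy⟩ => ?_
  obtain ⟨x, z, hz, hzx⟩ := denseRange_stoneCechUnit.exists_mem_open
    ((isOpen_Yset hloc).isOpenMap_subtype_val _ hU) ⟨y, mem_image_of_mem _ hy⟩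
  exact ⟨z, hz, x, Subtype.ext hzx.symm⟩

lemma tendsto_cocompact_iff_exists (hloc : ∀ x : X, ∃ L ∈ 𝓝 x, IsLindelof L)
    (g : Yset X → ℂ) :
    Tendsto g (cocompact _) (𝓝 0) ↔ ∃ M : Set X, IsClopen M ∧ IsLindelof M ∧
      ∀ y : Yset X, (y : StoneCech X) ∉ closure (stoneCechUnit '' M) → g y = 0 := by
  constructor
  · intro hg
    have hn : ∀ n : ℕ, ∃ t : Set (Yset X), IsCompact t ∧ ∀ y ∉ t, ‖g y‖ < 1 / (n + 1) := by
      intro n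
      obtain ⟨t, ht, hgt⟩ := mem_cocompact.1
        (hg (Metric.ball_mem_nhds 0 (Nat.one_div_pos_of_nat (α := ℝ) (n := n))))
      exact ⟨t, ht, fun y hy => by simpa using hgt hy⟩
    choose t ht hgt using hn
    obtain ⟨M, hM, hML, htM⟩ := exists_isClopen_isLindelof_of_iUnion_isCompact hloc
      (fun n => (ht n).image continuous_subtype_val)
      (fun n => Subtype.coe_image_subset (Yset X) (t n))
    refine ⟨M, hM, hML, fun y hy => ?_⟩
    have hle : ∀ n : ℕ, ‖g y‖ ≤ 1 / ((n : ℝ) + 1) := fun n =>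
      (hgt n y fun h => hy (htM n (mem_image_of_mem _ h))).le
    exact norm_le_zero_iff.1
      (ge_of_tendsto' (tendsto_one_div_add_atTop_nhds_zero_nat (𝕜 := ℝ)) hle)
  · rintro ⟨M, -, hML, hg⟩
    refine tendsto_const_nhds.congr' ?_
    filter_upwards [(isCompact_preimage_val_closure hML).compl_mem_cocompact] with y hy
    exact (hg y hy).symm

lemma setOf_hasCompactSupport_eq (hloc : ∀ x : X, ∃ L ∈ 𝓝 x, IsLindelof L) :
    {g : C(Yset X, ℂ) | HasCompactSupport (g : Yset X → ℂ)} =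
      {g : C(Yset X, ℂ) | Tendsto (g : Yset X → ℂ) (cocompact _) (𝓝 0)} := by
  ext g
  constructor
  · intro hg
    exact HasCompactSupport.is_zero_at_infty hg
  · intro hg
    obtain ⟨M, -, hML, hgM⟩ := (tendsto_cocompact_iff_exists hloc g).1 hg
    exact HasCompactSupport.intro (isCompact_preimage_val_closure hML) hgM

/-- Bounded continuous functions on `X` extend to `Yset X`, and the extension identifies `CL X`
with the functions vanishing at infinity. -/
lemma exists_extension_Yset (hloc : ∀ x : X, ∃ L ∈ 𝓝 x, IsLindelof L) :
    ∃ Φ : (X →ᵇ ℂ) → (Yset X →ᵇ ℂ), (∀ f x, Φ f (toYset x) = f x) ∧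
      ∀ f ∈ CL X, Tendsto (Φ f) (cocompact _) (𝓝 0) := by
  choose E hE using BoundedContinuousFunction.exists_stoneCech_extension (X := X)
  refine ⟨fun f => (mkOfCompact (E f)).compContinuous ⟨Subtype.val, continuous_subtype_val⟩,
    fun f x => hE f x, fun f hf => (tendsto_cocompact_iff_exists hloc _).2 ?_⟩
  obtain ⟨L, hL, hfL⟩ := (mem_CL_iff hloc).1 hf
  obtain ⟨M, hM, hML, hLM⟩ := IsLindelof.exists_isClopen_superset hloc hL
  refine ⟨M, hM, hML, fun y hy => ?_⟩
  have hsub : (closure (stoneCechUnit '' M))ᶜ ⊆ {y | E f y = 0} := by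
    refine (denseRange_stoneCechUnit.open_subset_closure_inter
      hM.isClopen_closure_stoneCech.compl.isOpen).trans
      (closure_minimal ?_ (isClosed_eq (E f).continuous continuous_const))
    rintro _ ⟨hx, x, rfl⟩
    exact (hE f x).trans (hfL x fun h => hx (subset_closure (mem_image_of_mem _ (hLM h))))
  exact hsub hy

lemma ext_toYset (hloc : ∀ x : X, ∃ L ∈ 𝓝 x, IsLindelof L) {g h : Yset X →ᵇ ℂ}
    (hgh : ∀ x, g (toYset x) = h (toYset x)) : g = h :=
  DFunLike.coe_injective
    ((denseRange_toYset hloc).equalizer g.continuous h.continuous (funext hgh))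

lemma comp_toYset_mem_CL (hloc : ∀ x : X, ∃ L ∈ 𝓝 x, IsLindelof L) {g : Yset X →ᵇ ℂ}
    (hg : Tendsto g (cocompact _) (𝓝 0)) :
    g.compContinuous ⟨toYset, continuous_toYset⟩ ∈ CL X := by
  obtain ⟨M, hM, hML, hgM⟩ := (tendsto_cocompact_iff_exists hloc g).1 hg
  exact (mem_CL_iff hloc).2
    ⟨M, hML, fun x hx => hgM _ fun h => hx (hM.stoneCechUnit_mem_closure_iff.1 h)⟩

lemma norm_eq_of_comp_toYset (hloc : ∀ x : X, ∃ L ∈ 𝓝 x, IsLindelof L) {g : Yset X →ᵇ ℂ}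
    {f : X →ᵇ ℂ} (hgf : ∀ x, g (toYset x) = f x) : ‖g‖ = ‖f‖ := by
  refine le_antisymm ((norm_le (norm_nonneg f)).2 fun y => ?_)
    ((norm_le (norm_nonneg g)).2 fun x => hgf x ▸ g.norm_coe_le_norm _)
  exact (denseRange_toYset hloc).induction_on y
    (isClosed_le g.continuous.norm continuous_const) fun x => hgf x ▸ f.norm_coe_le_norm x

end ContinuousOnYset

theorem stmt_17 {X : Type*} [TopologicalSpace X] [ParacompactSpace X] [T2Space X]
    (hloc : ∀ x : X, ∃ L ∈ nhds x, IsLindelof L) :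
    -- (a) `C_L(X)` is a closed ideal of `C_B(X)`
    ((∃ I : Ideal (X →ᵇ ℂ), (I : Set (X →ᵇ ℂ)) = CL X) ∧ IsClosed (CL X)) ∧
    -- (b) `Y` is open in `βX`, contains `X` densely, and `C_L(X) ≅ C_0(Y)` isometrically
    (IsOpen (Yset X) ∧
      Set.range (stoneCechUnit : X → StoneCech X) ⊆ Yset X ∧
      Dense {y : ↥(Yset X) |
        (y : StoneCech X) ∈ Set.range (stoneCechUnit : X → StoneCech X)} ∧
      (∃ Φ : (X →ᵇ ℂ) → (↥(Yset X) →ᵇ ℂ),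
        (∀ f ∈ CL X,
          Filter.Tendsto (Φ f : ↥(Yset X) → ℂ) (Filter.cocompact _) (nhds 0)) ∧
        (∀ g : ↥(Yset X) →ᵇ ℂ,
          Filter.Tendsto (g : ↥(Yset X) → ℂ) (Filter.cocompact _) (nhds 0) →
          ∃ f ∈ CL X, Φ f = g) ∧
        (∀ f ∈ CL X, ∀ g ∈ CL X, Φ f = Φ g → f = g) ∧
        (∀ f ∈ CL X, ∀ g ∈ CL X, Φ (f + g) = Φ f + Φ g) ∧
        (∀ f ∈ CL X, ∀ g ∈ CL X, Φ (f * g) = Φ f * Φ g) ∧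
        (∀ (c : ℂ), ∀ f ∈ CL X, Φ (c • f) = c • Φ f) ∧
        (∀ f ∈ CL X, ‖Φ f‖ = ‖f‖))) ∧
    -- (c) `Y` is countably compact and `C_0(Y) = C_00(Y)`
    (IsCountablyCompactSet (Yset X) ∧
      {g : C(↥(Yset X), ℂ) | HasCompactSupport (g : ↥(Yset X) → ℂ)} =
        {g : C(↥(Yset X), ℂ) |
          Filter.Tendsto (g : ↥(Yset X) → ℂ) (Filter.cocompact _) (nhds 0)}) ∧
    -- (d) `Y` normal ↔ `Y` compact ↔ `X` Lindelöf ↔ `C_L(X)` unital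
    ((NormalSpace ↥(Yset X) ↔ IsCompact (Yset X)) ∧
      (IsCompact (Yset X) ↔ IsLindelof (Set.univ : Set X)) ∧
      (IsLindelof (Set.univ : Set X) ↔ ∃ u ∈ CL X, ∀ f ∈ CL X, u * f = f)) := by
  refine ⟨⟨exists_ideal_eq_CL hloc, isClosed_CL hloc⟩,
    ⟨isOpen_Yset hloc, range_stoneCechUnit_subset_Yset, ?_, ?_⟩,
    ⟨isCountablyCompactSet_Yset hloc, setOf_hasCompactSupport_eq hloc⟩,
    ⟨?_, ?_⟩, isCompact_Yset_iff hloc, isLindelof_univ_iff_exists_unit hloc⟩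
  · refine (denseRange_toYset hloc).mono ?_
    rintro _ ⟨x, rfl⟩
    exact mem_range_self x
  · obtain ⟨Φ, hΦ, hΦ0⟩ := exists_extension_Yset hloc
    refine ⟨Φ, hΦ0, fun g hg => ⟨_, comp_toYset_mem_CL hloc hg, ext_toYset hloc fun x => hΦ _ x⟩,
      fun f _ g _ h => ?_, fun f _ g _ => ?_, fun f _ g _ => ?_, fun c f _ => ?_,
      fun f _ => norm_eq_of_comp_toYset hloc (hΦ f)⟩
    · ext x
      rw [← hΦ f, h, hΦ]
    · exact ext_toYset hloc fun x => by simp [hΦ]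
    · exact ext_toYset hloc fun x => by simp [hΦ]
    · exact ext_toYset hloc fun x => by simp [hΦ]
  · rw [isCompact_Yset_iff hloc]
    exact fun h => not_not.1 fun hX => not_normalSpace_Yset hloc hX h
  · intro h
    have := isCompact_iff_compactSpace.1 h
    infer_instance
end
end

section
/- Let X be a completely regular Hausdorff space, let f ∈ C_B(X), and let f_1, f_2, … be a sequence in C_B(X) such that {x ∈ X : |f(x)| ≥ 1/n} ⊆ {x ∈ X : |f_n(x)| ≥ 1} for every positive integer n. Then there is a sequence g_1, g_2, … in C_B(X) such that ‖g_n f_n − f‖ → 0 as n → ∞. -/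
open Set Filter Topology BoundedContinuousFunction

noncomputable section

/-- A bounded approximate quotient `f / u`, exact wherever `1 ≤ ‖u x‖`. -/
def truncatedQuotient {X : Type*} [TopologicalSpace X] (f u : X →ᵇ ℂ) : X →ᵇ ℂ :=
  BoundedContinuousFunction.ofNormedAddCommGroup
    (fun x => f x * (starRingEnd ℂ (u x) / ((max (‖u x‖ ^ 2) 1 : ℝ) : ℂ)))
    (by
      refine f.continuous.mul (Continuous.div ?_ ?_ fun x => ?_)
      · exact Complex.continuous_conj.comp u.continuous
      · exact Complex.continuous_ofReal.comp ((u.continuous.norm.pow 2).max continuous_const)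
      · exact Complex.ofReal_ne_zero.2 (lt_max_of_lt_right one_pos).ne')
    ‖f‖
    (fun x => by
      have hm : (0 : ℝ) < max (‖u x‖ ^ 2) 1 := lt_max_of_lt_right one_pos
      rw [norm_mul, norm_div, Complex.norm_real, RCLike.norm_conj, Real.norm_of_nonneg hm.le]
      have hq : ‖u x‖ / max (‖u x‖ ^ 2) 1 ≤ 1 := by
        rw [div_le_one hm]
        rcases le_total ‖u x‖ 1 with h1 | h1
        · exact le_max_of_le_right h1
        · exact le_max_of_le_left (by nlinarith)
      exact (mul_le_of_le_one_right (norm_nonneg _) hq).trans (f.norm_coe_le_norm x))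

theorem truncatedQuotient_mul_apply {X : Type*} [TopologicalSpace X] (f u : X →ᵇ ℂ) (x : X) :
    truncatedQuotient f u x * u x = f x * ((‖u x‖ ^ 2 / max (‖u x‖ ^ 2) 1 : ℝ) : ℂ) := by
  change f x * (starRingEnd ℂ (u x) / ((max (‖u x‖ ^ 2) 1 : ℝ) : ℂ)) * u x = _
  rw [mul_assoc, div_mul_eq_mul_div, Complex.conj_mul', Complex.ofReal_div, Complex.ofReal_pow]

theorem norm_truncatedQuotient_mul_sub_le {X : Type*} [TopologicalSpace X] (f u : X →ᵇ ℂ)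
    {ε : ℝ} (hε : 0 ≤ ε) (h : ∀ x, ε ≤ ‖f x‖ → 1 ≤ ‖u x‖) :
    ‖truncatedQuotient f u * u - f‖ ≤ ε := by
  refine (BoundedContinuousFunction.norm_le hε).2 fun x => ?_
  rw [BoundedContinuousFunction.sub_apply, BoundedContinuousFunction.mul_apply,
    truncatedQuotient_mul_apply]
  rcases le_or_gt 1 ‖u x‖ with hu | hu
  · have hu2 : 1 ≤ ‖u x‖ ^ 2 := one_le_pow₀ hu
    rw [max_eq_left hu2, div_self (by positivity)]
    simpa using hε
  · have hf : ‖f x‖ ≤ ε := (not_le.1 fun hf => hu.not_ge (h x hf)).le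
    have hu2 : ‖u x‖ ^ 2 ≤ 1 := pow_le_one₀ (norm_nonneg _) hu.le
    rw [max_eq_right hu2, div_one, ← mul_sub_one, norm_mul, ← Complex.ofReal_one,
      ← Complex.ofReal_sub, Complex.norm_real]
    refine (mul_le_of_le_one_right (norm_nonneg _) ?_).trans hf
    rw [Real.norm_eq_abs, abs_le]
    constructor <;> nlinarith [sq_nonneg ‖u x‖]

theorem stmt_19 {X : Type*} [TopologicalSpace X] [CompletelyRegularSpace X] [T2Space X]
    (f : X →ᵇ ℂ) (F : ℕ → (X →ᵇ ℂ))
    (h : ∀ n : ℕ, 0 < n →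
      {x : X | (1 : ℝ) / n ≤ ‖f x‖} ⊆ {x : X | 1 ≤ ‖F n x‖}) :
    ∃ g : ℕ → (X →ᵇ ℂ),
      Filter.Tendsto (fun n : ℕ => ‖g n * F n - f‖) Filter.atTop (nhds 0) := by
  refine ⟨fun n => truncatedQuotient f (F n), ?_⟩
  refine squeeze_zero' (Eventually.of_forall fun _ => norm_nonneg _) ?_
    (tendsto_one_div_atTop_nhds_zero_nat (𝕜 := ℝ))
  filter_upwards [eventually_gt_atTop 0] with n hn
  exact norm_truncatedQuotient_mul_sub_le f (F n) (by positivity) fun x hx => h n hn hx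
end
end
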